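/- arXiv:math/9412211 — 2 statements merged into one kernel-verified Lean document; each statement's English description precedes it below -/
import Mathlib

section
/- Let Y be a real Banach space, (Ω,Σ,μ) a finite measure space, and m : Σ → Y a countably additive vector measure that is absolutely continuous with respect to μ (μ(A) = 0 implies m(A) = 0). Then the net (m_π) of conditional expectations of m, directed by refinement of finite measurable partitions, converges to m in semivariation norm if and only if the range {m(B) : B ∈ Σ} is relatively norm-compact in Y. -/
open MeasureTheory

/-- A finite measurable partition of `Ω`: a finite collection of pairwise disjoint
measurable sets whose union is `Ω`. -/
structure FinPartition (Ω : Type*) [MeasurableSpace Ω] where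
  parts : Finset (Set Ω)
  measurableSet : ∀ A ∈ parts, MeasurableSet A
  disjoint : ∀ A ∈ parts, ∀ B ∈ parts, A ≠ B → Disjoint A B
  sUnion_eq : ⋃₀ (parts : Set (Set Ω)) = (Set.univ : Set Ω)

/-- `π'` refines `π` if every member of `π'` is contained in some member of `π`. -/
def FinPartition.Refines {Ω : Type*} [MeasurableSpace Ω] (π' π : FinPartition Ω) : Prop :=
  ∀ A ∈ π'.parts, ∃ B ∈ π.parts, A ⊆ B

/-- A finitely additive set function on the measurable sets. -/
def FinitelyAdditive {Ω : Type*} [MeasurableSpace Ω] {X : Type*} [AddCommMonoid X]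
    (m : Set Ω → X) : Prop :=
  ∀ A B : Set Ω, MeasurableSet A → MeasurableSet B → Disjoint A B → m (A ∪ B) = m A + m B

/-- A countably additive set function (vector measure) on the measurable sets. -/
def CountablyAdditive {Ω : Type*} [MeasurableSpace Ω] {X : Type*} [AddCommMonoid X]
    [TopologicalSpace X] (m : Set Ω → X) : Prop :=
  ∀ f : ℕ → Set Ω, (∀ n, MeasurableSet (f n)) → Pairwise (Function.onFun Disjoint f) →
    HasSum (fun n => m (f n)) (m (⋃ n, f n))

/-- The conditional expectation `m_π` of a set function `m` by the partition `π` and the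
measure `μ`:  `m_π(B) = ∑_{A ∈ π} (μ(A ∩ B)/μ(A)) • m(A)`, with the convention `0/0 = 0`
(so the terms with `μ(A) = 0` vanish). -/
noncomputable def partCondExp {Ω : Type*} [MeasurableSpace Ω] {X : Type*}
    [AddCommMonoid X] [Module ℝ X] (μ : Measure Ω) (m : Set Ω → X)
    (π : FinPartition Ω) (B : Set Ω) : X :=
  ∑ A ∈ π.parts, ((μ (A ∩ B)).toReal / (μ A).toReal) • m A

section Additivity

variable {Ω : Type*} [MeasurableSpace Ω]

theorem FinitelyAdditive.sum_eq {X : Type*} [AddCommMonoid X] {m : Set Ω → X}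
    (hm : FinitelyAdditive m) (h0 : m ∅ = 0) (s : Finset (Set Ω))
    (hs : ∀ A ∈ s, MeasurableSet A) (hd : ∀ A ∈ s, ∀ B ∈ s, A ≠ B → Disjoint A B) :
    ∑ A ∈ s, m A = m (⋃₀ (s : Set (Set Ω))) := by
  classical
  induction s using Finset.induction_on with
  | empty => simp [h0]
  | insert A s hA ih =>
    have hsm : MeasurableSet (⋃₀ (s : Set (Set Ω))) :=
      MeasurableSet.sUnion s.countable_toSet fun B hB => hs B (Finset.mem_insert_of_mem hB)
    have hdis : Disjoint A (⋃₀ (s : Set (Set Ω))) := by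
      refine Set.disjoint_sUnion_right.2 fun B hB => ?_
      refine hd A (Finset.mem_insert_self A s) B (Finset.mem_insert_of_mem hB) ?_
      rintro rfl
      exact hA hB
    rw [Finset.sum_insert hA, Finset.coe_insert, Set.sUnion_insert,
      hm _ _ (hs A (Finset.mem_insert_self A s)) hsm hdis,
      ih (fun B hB => hs B (Finset.mem_insert_of_mem hB)) fun B hB C hC =>
        hd B (Finset.mem_insert_of_mem hB) C (Finset.mem_insert_of_mem hC)]

theorem FinitelyAdditive.sub {X : Type*} [AddCommGroup X] {m n : Set Ω → X}
    (hm : FinitelyAdditive m) (hn : FinitelyAdditive n) :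
    FinitelyAdditive fun A => m A - n A := by
  intro A B hA hB hAB
  simp only [hm A B hA hB hAB, hn A B hA hB hAB]
  abel

theorem FinitelyAdditive.map {X Z : Type*} [AddCommMonoid X] [AddCommMonoid Z] {m : Set Ω → X}
    (hm : FinitelyAdditive m) (f : X →+ Z) : FinitelyAdditive fun A => f (m A) := by
  intro A B hA hB hAB
  simp only [hm A B hA hB hAB, map_add]

theorem CountablyAdditive.finitelyAdditive {X : Type*} [AddCommMonoid X] [TopologicalSpace X]
    [T2Space X] {m : Set Ω → X} (hm : CountablyAdditive m) (h0 : m ∅ = 0) :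
    FinitelyAdditive m := by
  let v : VectorMeasure Ω X :=
    { measureOf' := fun A => open Classical in if MeasurableSet A then m A else 0
      empty' := by simp [h0]
      not_measurable' := fun A hA => if_neg hA
      m_iUnion' := fun f hf hd => by
        simpa [hf, MeasurableSet.iUnion hf] using hm f hf hd }
  have hv : ∀ A, MeasurableSet A → v A = m A := fun A hA => if_pos hA
  intro A B hA hB hAB
  rw [← hv A hA, ← hv B hB, ← hv _ (hA.union hB), VectorMeasure.of_union hAB hA hB]

theorem FinitelyAdditive.sum_abs_le {n : Set Ω → ℝ} (hn : FinitelyAdditive n) (h0 : n ∅ = 0)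
    {δ : ℝ} (hδ : ∀ A, MeasurableSet A → |n A| ≤ δ) (σ : FinPartition Ω) :
    ∑ A ∈ σ.parts, |n A| ≤ 2 * δ := by
  classical
  have key : ∀ s ⊆ σ.parts, |∑ A ∈ s, n A| ≤ δ := fun s hs => by
    rw [hn.sum_eq h0 s (fun A hA => σ.measurableSet A (hs hA))
      fun A hA B hB => σ.disjoint A (hs hA) B (hs hB)]
    exact hδ _ (MeasurableSet.sUnion s.countable_toSet fun A hA => σ.measurableSet A (hs hA))
  rw [← Finset.sum_filter_add_sum_filter_not σ.parts (fun A => 0 ≤ n A)]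
  have hpos : ∑ A ∈ σ.parts with 0 ≤ n A, |n A| = ∑ A ∈ σ.parts with 0 ≤ n A, n A :=
    Finset.sum_congr rfl fun A hA => abs_of_nonneg (Finset.mem_filter.1 hA).2
  have hneg : ∑ A ∈ σ.parts with ¬ 0 ≤ n A, |n A| = -∑ A ∈ σ.parts with ¬ 0 ≤ n A, n A := by
    rw [← Finset.sum_neg_distrib]
    exact Finset.sum_congr rfl fun A hA => abs_of_neg (not_le.1 (Finset.mem_filter.1 hA).2)
  have h1 := abs_le.1 (key _ (Finset.filter_subset (fun A => 0 ≤ n A) σ.parts))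
  have h2 := abs_le.1 (key _ (Finset.filter_subset (fun A => ¬ 0 ≤ n A) σ.parts))
  rw [hpos, hneg]
  linarith [h1.2, h2.1]

theorem finitelyAdditive_measure_inter (μ : Measure Ω) [IsFiniteMeasure μ] {A : Set Ω}
    (hA : MeasurableSet A) : FinitelyAdditive fun B => (μ (A ∩ B)).toReal := by
  intro B C hB hC hBC
  simp only [Set.inter_union_distrib_left]
  rw [measure_union (hBC.mono Set.inter_subset_right Set.inter_subset_right) (hA.inter hC),
    ENNReal.toReal_add (measure_ne_top _ _) (measure_ne_top _ _)]

theorem FinPartition.sum_measure_inter (μ : Measure Ω) [IsFiniteMeasure μ] (σ : FinPartition Ω)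
    {A : Set Ω} (hA : MeasurableSet A) :
    ∑ B ∈ σ.parts, (μ (A ∩ B)).toReal = (μ A).toReal := by
  rw [(finitelyAdditive_measure_inter μ hA).sum_eq (by simp) _ σ.measurableSet σ.disjoint,
    σ.sUnion_eq, Set.inter_univ]

theorem finitelyAdditive_setIntegral {μ : Measure Ω} {g : Ω → ℝ} (hg : Integrable g μ) :
    FinitelyAdditive fun A => ∫ ω in A, g ω ∂μ := fun _ _ _ hB hAB =>
  setIntegral_union hAB hB hg.integrableOn hg.integrableOn

end Additivity

section ConditionalExpectation

variable {Ω : Type*} [MeasurableSpace Ω]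

theorem map_partCondExp {X Z F : Type*} [AddCommGroup X] [Module ℝ X] [AddCommGroup Z]
    [Module ℝ Z] [FunLike F X Z] [LinearMapClass F ℝ X Z] (f : F) (μ : Measure Ω)
    (m : Set Ω → X) (π : FinPartition Ω) (B : Set Ω) :
    f (partCondExp μ m π B) = partCondExp μ (fun A => f (m A)) π B := by
  simp [partCondExp]

theorem partCondExp_sub {X : Type*} [AddCommGroup X] [Module ℝ X] (μ : Measure Ω)
    (m n : Set Ω → X) (π : FinPartition Ω) (B : Set Ω) :
    partCondExp μ (fun A => m A - n A) π B = partCondExp μ m π B - partCondExp μ n π B := by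
  simp [partCondExp, smul_sub]

theorem measure_inter_div_mem_Icc (μ : Measure Ω) [IsFiniteMeasure μ] (A B : Set Ω) :
    (μ (A ∩ B)).toReal / (μ A).toReal ∈ Set.Icc (0 : ℝ) 1 :=
  ⟨by positivity, div_le_one_of_le₀
    (ENNReal.toReal_mono (measure_ne_top _ _) (measure_mono Set.inter_subset_left))
    ENNReal.toReal_nonneg⟩

theorem sum_abs_partCondExp_le (μ : Measure Ω) [IsFiniteMeasure μ] (n : Set Ω → ℝ)
    (π σ : FinPartition Ω) :
    ∑ B ∈ σ.parts, |partCondExp μ n π B| ≤ ∑ A ∈ π.parts, |n A| := by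
  calc ∑ B ∈ σ.parts, |partCondExp μ n π B|
      ≤ ∑ B ∈ σ.parts, ∑ A ∈ π.parts, (μ (A ∩ B)).toReal / (μ A).toReal * |n A| := by
        refine Finset.sum_le_sum fun B _ => (Finset.abs_sum_le_sum_abs _ _).trans_eq ?_
        refine Finset.sum_congr rfl fun A _ => ?_
        rw [smul_eq_mul, abs_mul, abs_of_nonneg (measure_inter_div_mem_Icc μ A B).1]
    _ = ∑ A ∈ π.parts, (μ A).toReal / (μ A).toReal * |n A| := by
        rw [Finset.sum_comm]
        refine Finset.sum_congr rfl fun A hA => ?_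
        rw [← Finset.sum_mul, ← Finset.sum_div, σ.sum_measure_inter μ (π.measurableSet A hA)]
    _ ≤ ∑ A ∈ π.parts, |n A| :=
        Finset.sum_le_sum fun A _ => mul_le_of_le_one_left (abs_nonneg _) (div_self_le_one _)

/-- The indefinite integral of a function that is constant on every member of `π` is its own
conditional expectation by `π`. -/
theorem partCondExp_setIntegral {μ : Measure Ω} [IsFiniteMeasure μ] {g : Ω → ℝ}
    (hg : Integrable g μ) (π : FinPartition Ω)
    (hπ : ∀ A ∈ π.parts, ∃ c, ∀ ω ∈ A, g ω = c) {B : Set Ω} (hB : MeasurableSet B) :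
    partCondExp μ (fun A => ∫ ω in A, g ω ∂μ) π B = ∫ ω in B, g ω ∂μ := by
  have hadd : FinitelyAdditive fun A => ∫ ω in A ∩ B, g ω ∂μ := by
    intro A C hA hC hAC
    simp only [Set.union_inter_distrib_right]
    exact finitelyAdditive_setIntegral hg _ _ (hA.inter hB) (hC.inter hB)
      (hAC.mono Set.inter_subset_left Set.inter_subset_left)
  have hsum := hadd.sum_eq (by simp) _ π.measurableSet π.disjoint
  rw [π.sUnion_eq, Set.univ_inter] at hsum
  rw [← hsum, partCondExp]
  refine Finset.sum_congr rfl fun A hA => ?_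
  obtain ⟨c, hc⟩ := hπ A hA
  have hAm := π.measurableSet A hA
  rw [setIntegral_congr_fun hAm hc, setIntegral_congr_fun (hAm.inter hB) fun ω hω => hc ω hω.1,
    setIntegral_const, setIntegral_const, measureReal_def, measureReal_def, smul_eq_mul,
    smul_eq_mul, smul_eq_mul]
  rcases eq_or_ne (μ A).toReal 0 with h | h
  · have h' : (μ (A ∩ B)).toReal = 0 := le_antisymm
      (h ▸ ENNReal.toReal_mono (measure_ne_top _ _) (measure_mono Set.inter_subset_left))
      ENNReal.toReal_nonneg
    simp [h, h']
  · field_simp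

/-- If `n` is uniformly `δ`-close to the indefinite integral of a function that is constant on
every member of `π`, then `n` is `4 * δ`-close in variation to its conditional expectation. -/
theorem sum_abs_partCondExp_sub_le {μ : Measure Ω} [IsFiniteMeasure μ] {n : Set Ω → ℝ}
    (hn : FinitelyAdditive n) (h0 : n ∅ = 0) {g : Ω → ℝ} (hg : Integrable g μ) {δ : ℝ}
    (hδ : ∀ A, MeasurableSet A → |n A - ∫ ω in A, g ω ∂μ| ≤ δ) (π σ : FinPartition Ω)
    (hπ : ∀ A ∈ π.parts, ∃ c, ∀ ω ∈ A, g ω = c) :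
    ∑ B ∈ σ.parts, |partCondExp μ n π B - n B| ≤ 4 * δ := by
  set d : Set Ω → ℝ := fun A => n A - ∫ ω in A, g ω ∂μ with hd
  have hvar : ∀ τ : FinPartition Ω, ∑ A ∈ τ.parts, |d A| ≤ 2 * δ :=
    (hn.sub (finitelyAdditive_setIntegral hg)).sum_abs_le (by simp [h0]) hδ
  calc ∑ B ∈ σ.parts, |partCondExp μ n π B - n B|
      = ∑ B ∈ σ.parts, |partCondExp μ d π B - d B| := by
        refine Finset.sum_congr rfl fun B hB => ?_
        rw [hd, partCondExp_sub, partCondExp_setIntegral hg π hπ (σ.measurableSet B hB)]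
        congr 1
        ring
    _ ≤ ∑ B ∈ σ.parts, (|partCondExp μ d π B| + |d B|) :=
        Finset.sum_le_sum fun B _ => abs_sub _ _
    _ ≤ 4 * δ := by
        rw [Finset.sum_add_distrib]
        linarith [sum_abs_partCondExp_le μ d π σ, hvar π, hvar σ]

end ConditionalExpectation

section Approximation

variable {Ω : Type*} [MeasurableSpace Ω]

/-- A real measure absolutely continuous with respect to a finite measure is uniformly close to
the indefinite integral of a simple function. -/
theorem exists_simpleFunc_setIntegral_close {μ : Measure Ω} [IsFiniteMeasure μ] {n : Set Ω → ℝ}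
    (hn : CountablyAdditive n) (hac : ∀ A, MeasurableSet A → μ A = 0 → n A = 0) {δ : ℝ}
    (hδ : 0 < δ) :
    ∃ g : SimpleFunc Ω ℝ, Integrable g μ ∧
      ∀ A, MeasurableSet A → |n A - ∫ ω in A, g ω ∂μ| ≤ δ := by
  let v : SignedMeasure Ω :=
    { measureOf' := fun A => open Classical in if MeasurableSet A then n A else 0
      empty' := by simp [hac]
      not_measurable' := fun A hA => if_neg hA
      m_iUnion' := fun f hf hd => by
        simpa [hf, MeasurableSet.iUnion hf] using hn f hf hd }
  have hv : ∀ A, MeasurableSet A → v A = n A := fun A hA => if_pos hA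
  have hvac : v ≪ᵥ μ.toENNRealVectorMeasure := by
    refine VectorMeasure.AbsolutelyContinuous.mk fun A hA h => ?_
    rw [Measure.toENNRealVectorMeasure_apply_measurable hA] at h
    rw [hv A hA, hac A hA h]
  have hf : Integrable (v.rnDeriv μ) μ := SignedMeasure.integrable_rnDeriv v μ
  have hfv : ∀ A, MeasurableSet A → n A = ∫ ω in A, v.rnDeriv μ ω ∂μ := fun A hA => by
    rw [← withDensityᵥ_apply hf hA, SignedMeasure.withDensityᵥ_rnDeriv_eq v μ hvac, hv A hA]
  obtain ⟨g, hg, hgL⟩ := (memLp_one_iff_integrable.2 hf).exists_simpleFunc_eLpNorm_sub_lt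
    ENNReal.one_ne_top (ENNReal.ofReal_pos.2 hδ).ne'
  have hgi := memLp_one_iff_integrable.1 hgL
  refine ⟨g, hgi, fun A hA => ?_⟩
  rw [hfv A hA, ← integral_sub hf.integrableOn hgi.integrableOn]
  calc |∫ ω in A, (v.rnDeriv μ ω - g ω) ∂μ|
      ≤ ∫ ω in A, ‖v.rnDeriv μ ω - g ω‖ ∂μ := abs_integral_le_integral_abs
    _ ≤ ∫ ω, ‖v.rnDeriv μ ω - g ω‖ ∂μ :=
        setIntegral_le_integral (hf.sub hgi).norm (ae_of_all _ fun _ => norm_nonneg _)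
    _ = (eLpNorm (v.rnDeriv μ - ⇑g) 1 μ).toReal := by
        rw [eLpNorm_one_eq_lintegral_enorm]
        exact integral_norm_eq_lintegral_enorm (hf.sub hgi).aestronglyMeasurable
    _ ≤ δ := ENNReal.toReal_le_of_le_ofReal hδ.le hg.le

/-- The partition of the space into the level sets of a simple function. -/
noncomputable def MeasureTheory.SimpleFunc.finPartition {β : Type*} (g : SimpleFunc Ω β) :
    FinPartition Ω where
  parts := open Classical in g.range.image fun b => g ⁻¹' {b}
  measurableSet := by
    simp only [Finset.mem_image]
    rintro _ ⟨b, _, rfl⟩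
    exact g.measurableSet_fiber b
  disjoint := by
    simp only [Finset.mem_image]
    rintro _ ⟨b, _, rfl⟩ _ ⟨c, _, rfl⟩ hbc
    refine Disjoint.preimage _ (Set.disjoint_singleton.2 ?_)
    rintro rfl
    exact hbc rfl
  sUnion_eq := by
    refine Set.eq_univ_of_forall fun ω => Set.mem_sUnion.2 ⟨g ⁻¹' {g ω}, ?_, rfl⟩
    exact Finset.mem_coe.2 (Finset.mem_image_of_mem _ (g.mem_range_self ω))

/-- Every finite family of simple functions is constant on the members of all sufficiently fine
partitions. -/
theorem exists_finPartition_forall_const {ι : Type*} [Finite ι] (g : ι → SimpleFunc Ω ℝ) :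
    ∃ π₀ : FinPartition Ω, ∀ π : FinPartition Ω, π.Refines π₀ → ∀ i, ∀ A ∈ π.parts,
      ∃ c, ∀ ω ∈ A, g i ω = c := by
  let G : SimpleFunc Ω (ι → ℝ) :=
    { toFun := fun ω i => g i ω
      measurableSet_fiber' := fun b => by
        have : (fun ω i => g i ω) ⁻¹' {b} = ⋂ i, g i ⁻¹' {b i} := by
          ext ω
          simp [funext_iff]
        rw [this]
        exact MeasurableSet.iInter fun i => (g i).measurableSet_fiber (b i)
      finite_range' := by
        refine (Set.Finite.pi' fun i => (g i).finite_range).subset ?_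
        rintro _ ⟨ω, rfl⟩ i
        exact Set.mem_range_self ω }
  refine ⟨G.finPartition, fun π hπ i A hA => ?_⟩
  obtain ⟨C, hC, hAC⟩ := hπ A hA
  obtain ⟨b, _, rfl⟩ := Finset.mem_image.1 hC
  exact ⟨b i, fun ω hω => congrFun (hAC hω) i⟩

/-- On a totally bounded set, the dual unit ball is totally bounded for uniform convergence. -/
theorem exists_finite_dual_net {Y : Type*} [NormedAddCommGroup Y] [NormedSpace ℝ Y] {K : Set Y}
    (hK : TotallyBounded K) {δ : ℝ} (hδ : 0 < δ) :
    ∃ t : Set (StrongDual ℝ Y), t.Finite ∧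
      ∀ f : StrongDual ℝ Y, ‖f‖ ≤ 1 → ∃ z ∈ t, ∀ x ∈ K, |f x - z x| ≤ δ := by
  obtain ⟨F, hFfin, hF⟩ := Metric.totallyBounded_iff.1 hK (δ / 4) (by positivity)
  have := hFfin.fintype
  let Φ : StrongDual ℝ Y → F → ℝ := fun f x => f x
  have hb : TotallyBounded (Φ '' Metric.closedBall 0 1) := by
    refine ((isCompact_univ_pi fun x : F =>
      isCompact_Icc (a := -‖(x : Y)‖) (b := ‖(x : Y)‖)).totallyBounded).subset ?_
    rintro _ ⟨f, hf, rfl⟩ x _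
    rw [mem_closedBall_zero_iff] at hf
    exact abs_le.1 ((f.le_of_opNorm_le hf x).trans_eq (one_mul _))
  have hnet := Metric.finite_approx_of_totallyBounded hb (δ / 4) (by positivity)
  simp only [← and_assoc] at hnet
  obtain ⟨s, ⟨hs, hsfin⟩, hcov⟩ := hnet
  obtain ⟨t, ht, htfin, rfl⟩ := Set.exists_subset_image_finite_and.1
    ⟨s, hs, hsfin, (rfl : s = s)⟩
  refine ⟨t, htfin, fun f hf => ?_⟩
  have hfm := hcov (Set.mem_image_of_mem Φ (mem_closedBall_zero_iff.2 hf))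
  simp only [Set.mem_iUnion, Set.mem_image, exists_prop, exists_exists_and_eq_and] at hfm
  obtain ⟨z, hz, hfz⟩ := hfm
  have hz1 : ‖z‖ ≤ 1 := mem_closedBall_zero_iff.1 (ht hz)
  refine ⟨z, hz, fun x hx => ?_⟩
  obtain ⟨y, hy, hxy⟩ := Set.mem_iUnion₂.1 (hF hx)
  rw [Metric.mem_ball, dist_eq_norm] at hxy
  have h1 : |f (x - y)| ≤ ‖x - y‖ := (f.le_of_opNorm_le hf _).trans_eq (one_mul _)
  have h2 : |z (x - y)| ≤ ‖x - y‖ := (z.le_of_opNorm_le hz1 _).trans_eq (one_mul _)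
  have h3 : |f y - z y| < δ / 4 := (dist_le_pi_dist (Φ f) (Φ z) ⟨y, hy⟩).trans_lt hfz
  rw [map_sub] at h1 h2
  rw [abs_le] at h1 h2 ⊢
  rw [abs_lt] at h3
  constructor <;> linarith [h1.1, h1.2, h2.1, h2.2, h3.1, h3.2]

end Approximation

section Range

variable {Ω Y : Type*} [MeasurableSpace Ω] [NormedAddCommGroup Y] [NormedSpace ℝ Y]

theorem totallyBounded_range_partCondExp (μ : Measure Ω) [IsFiniteMeasure μ] (m : Set Ω → Y)
    (π : FinPartition Ω) : TotallyBounded (Set.range (partCondExp μ m π)) := by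
  have hcont : Continuous fun t : Set Ω → ℝ => ∑ A ∈ π.parts, t A • m A := by fun_prop
  refine (((isCompact_univ_pi fun _ : Set Ω => isCompact_Icc (a := (0 : ℝ)) (b := 1)).image
    hcont).totallyBounded).subset ?_
  rintro _ ⟨B, rfl⟩
  exact ⟨fun A => (μ (A ∩ B)).toReal / (μ A).toReal,
    fun A _ => measure_inter_div_mem_Icc μ A B, rfl⟩

/-- The partition of the space into a measurable set and its complement. -/
noncomputable def FinPartition.ofSet (B : Set Ω) (hB : MeasurableSet B) : FinPartition Ω where
  parts := open Classical in {B, Bᶜ}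
  measurableSet := by simp [hB]
  disjoint := by
    simp +contextual [disjoint_compl_right, disjoint_compl_left]
  sUnion_eq := by simp

theorem totallyBounded_range_of_tendsto (μ : Measure Ω) [IsFiniteMeasure μ] (m : Set Ω → Y)
    (h : ∀ ε : ℝ, 0 < ε → ∃ π : FinPartition Ω, ∀ (σ : FinPartition Ω) (c : Set Ω → ℝ),
      (∀ A ∈ σ.parts, |c A| ≤ 1) → ‖∑ A ∈ σ.parts, c A • (partCondExp μ m π A - m A)‖ < ε) :
    TotallyBounded {y : Y | ∃ B : Set Ω, MeasurableSet B ∧ m B = y} := by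
  classical
  refine Metric.totallyBounded_iff.2 fun ε hε => ?_
  obtain ⟨π, hπ⟩ := h (ε / 2) (half_pos hε)
  obtain ⟨t, ht, hcov⟩ := Metric.totallyBounded_iff.1
    (totallyBounded_range_partCondExp μ m π) (ε / 2) (half_pos hε)
  refine ⟨t, ht, ?_⟩
  rintro _ ⟨B, hB, rfl⟩
  obtain ⟨y, hy, hBy⟩ := Set.mem_iUnion₂.1 (hcov ⟨B, rfl⟩)
  have hclose := hπ (FinPartition.ofSet B hB) (fun A => if A = B then 1 else 0)
    fun A _ => by split_ifs <;> simp
  have hmem : B ∈ (FinPartition.ofSet B hB).parts := by simp [FinPartition.ofSet]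
  simp only [ite_smul, one_smul, zero_smul, Finset.sum_ite_eq', hmem, if_true] at hclose
  refine Set.mem_iUnion₂.2 ⟨y, hy, ?_⟩
  rw [Metric.mem_ball] at hBy ⊢
  rw [← dist_eq_norm] at hclose
  linarith [dist_triangle_left (m B) y (partCondExp μ m π B)]

theorem exists_finPartition_of_totallyBounded_range (μ : Measure Ω) [IsFiniteMeasure μ]
    (m : Set Ω → Y) (hca : CountablyAdditive m)
    (hac : ∀ A : Set Ω, MeasurableSet A → μ A = 0 → m A = 0)
    (hK : TotallyBounded {y : Y | ∃ B : Set Ω, MeasurableSet B ∧ m B = y}) {ε : ℝ} (hε : 0 < ε) :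
    ∃ π₀ : FinPartition Ω, ∀ π : FinPartition Ω, π.Refines π₀ →
      ∀ (σ : FinPartition Ω) (c : Set Ω → ℝ), (∀ A ∈ σ.parts, |c A| ≤ 1) →
        ‖∑ A ∈ σ.parts, c A • (partCondExp μ m π A - m A)‖ < ε := by
  have h0 : m ∅ = 0 := hac ∅ MeasurableSet.empty measure_empty
  obtain ⟨t, htfin, ht⟩ := exists_finite_dual_net hK (δ := ε / 16) (by positivity)
  have hsimple : ∀ z : t, ∃ g : SimpleFunc Ω ℝ, Integrable g μ ∧
      ∀ A, MeasurableSet A → |z.1 (m A) - ∫ ω in A, g ω ∂μ| ≤ ε / 16 := fun z =>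
    exists_simpleFunc_setIntegral_close
      (fun f hf hd => (hca f hf hd).mapL z.1)
      (fun A hA h => by simp [hac A hA h]) (by positivity)
  choose g hgi hg using hsimple
  have := htfin.to_subtype
  obtain ⟨π₀, hπ₀⟩ := exists_finPartition_forall_const g
  refine ⟨π₀, fun π hπ σ c hc => ?_⟩
  obtain ⟨f, hf1, hf⟩ := exists_dual_vector'' ℝ
    (∑ A ∈ σ.parts, c A • (partCondExp μ m π A - m A))
  obtain ⟨z, hz, hfz⟩ := ht f hf1
  have hclose : ∀ A, MeasurableSet A → |f (m A) - ∫ ω in A, g ⟨z, hz⟩ ω ∂μ| ≤ ε / 8 :=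
    fun A hA => by
      have h1 := hfz (m A) ⟨A, hA, rfl⟩
      have h2 := hg ⟨z, hz⟩ A hA
      linarith [abs_sub_le (f (m A)) (z (m A)) (∫ ω in A, g ⟨z, hz⟩ ω ∂μ)]
  have hvar := sum_abs_partCondExp_sub_le
    ((hca.finitelyAdditive h0).map (f : Y →+ ℝ)) (by simp [h0]) (hgi ⟨z, hz⟩) hclose π σ
    (hπ₀ π hπ ⟨z, hz⟩)
  calc ‖∑ A ∈ σ.parts, c A • (partCondExp μ m π A - m A)‖
      = ∑ A ∈ σ.parts, c A * (partCondExp μ (fun B => f (m B)) π A - f (m A)) := by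
        refine hf.symm.trans ?_
        simp only [map_sum, map_smul, map_sub, map_partCondExp, smul_eq_mul]
    _ ≤ ∑ A ∈ σ.parts, |partCondExp μ (fun B => f (m B)) π A - f (m A)| :=
        Finset.sum_le_sum fun A hA => (le_abs_self _).trans <| by
          rw [abs_mul]
          exact mul_le_of_le_one_left (abs_nonneg _) (hc A hA)
    _ ≤ 4 * (ε / 8) := hvar
    _ < ε := by linarith

end Range

/-- measure-theoretic form of Theorem 2, (1) ⇔ (2).
For a countably additive vector measure `m : Σ → Y` with `m ≪ μ` on a finite measure space,
the net `(m_π)` converges to `m` in semivariation norm iff the range of `m` is relatively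
norm-compact in `Y`. -/
theorem statement2 {Ω Y : Type*} [MeasurableSpace Ω]
    [NormedAddCommGroup Y] [NormedSpace ℝ Y] [CompleteSpace Y]
    (μ : Measure Ω) [IsFiniteMeasure μ] (m : Set Ω → Y)
    (hca : CountablyAdditive m)
    (hac : ∀ A : Set Ω, MeasurableSet A → μ A = 0 → m A = 0) :
    (∀ ε : ℝ, 0 < ε → ∃ π₀ : FinPartition Ω, ∀ π : FinPartition Ω, π.Refines π₀ →
      ∀ (σ : FinPartition Ω) (c : Set Ω → ℝ), (∀ A ∈ σ.parts, |c A| ≤ 1) →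
        ‖∑ A ∈ σ.parts, c A • (partCondExp μ m π A - m A)‖ < ε) ↔
    IsCompact (closure {y : Y | ∃ B : Set Ω, MeasurableSet B ∧ m B = y}) := by
  refine ⟨fun h => ?_, fun h ε hε => ?_⟩
  · refine TotallyBounded.isCompact_of_isClosed (TotallyBounded.closure ?_) isClosed_closure
    refine totallyBounded_range_of_tendsto μ m fun ε hε => ?_
    obtain ⟨π₀, hπ₀⟩ := h ε hε
    exact ⟨π₀, hπ₀ π₀ fun A hA => ⟨A, hA, subset_rfl⟩⟩
  · exact exists_finPartition_of_totallyBounded_range μ m hca hac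
      (h.totallyBounded.subset subset_closure) hε
end

section
/- Let λ denote Lebesgue measure on [0,1]. For each Borel set A ⊆ [0,1], let φ_A ∈ C([0,1],ℝ)* be the continuous linear functional φ_A(g) = ∫_A g dλ. Then the set {φ_A : A a Borel subset of [0,1]} is not relatively compact (equivalently, not totally bounded) in the norm of the dual space C([0,1],ℝ)*. -/
open MeasureTheory

open Filter Topology

/-- A norm-bounded sequence on which every member of a totally bounded set of functionals tends
to zero does so uniformly over that set. -/
theorem TotallyBounded.eventually_forall_norm_apply_lt {E : Type*} [NormedAddCommGroup E]
    [NormedSpace ℝ E] {s : Set (E →L[ℝ] ℝ)} (hs : TotallyBounded s) {g : ℕ → E}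
    (hg : ∀ n, ‖g n‖ ≤ 1) (hlim : ∀ ψ ∈ s, Tendsto (fun n => ψ (g n)) atTop (𝓝 0))
    {ε : ℝ} (hε : 0 < ε) : ∀ᶠ n in atTop, ∀ ψ ∈ s, ‖ψ (g n)‖ < ε := by
  obtain ⟨t, hts, htf, hcov⟩ := Metric.finite_approx_of_totallyBounded hs (ε / 2) (half_pos hε)
  have hsmall : ∀ᶠ n in atTop, ∀ χ ∈ t, ‖χ (g n)‖ < ε / 2 :=
    (eventually_all_finite htf).2 fun χ hχ => by
      simpa using (hlim χ (hts hχ)).norm.eventually_lt_const (by simpa using hε)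
  filter_upwards [hsmall] with n hn ψ hψ
  obtain ⟨χ, hχ, hdist⟩ := Set.mem_iUnion₂.1 (hcov hψ)
  rw [mem_ball_iff_norm] at hdist
  calc ‖ψ (g n)‖ = ‖(ψ - χ) (g n) + χ (g n)‖ := by simp
    _ ≤ ‖(ψ - χ) (g n)‖ + ‖χ (g n)‖ := norm_add_le _ _
    _ ≤ ‖ψ - χ‖ + ‖χ (g n)‖ := by
      gcongr
      exact (ψ - χ).unit_le_opNorm _ (hg n)
    _ < ε := by linarith [hn χ hχ]

/-- The function `t ↦ cos (2πnt)` on the unit interval. -/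
noncomputable def unitIntervalCos (n : ℕ) : C(unitInterval, ℝ) where
  toFun t := Real.cos (2 * Real.pi * (t * n))

theorem norm_unitIntervalCos_le_one (n : ℕ) : ‖unitIntervalCos n‖ ≤ 1 :=
  (ContinuousMap.norm_le _ zero_le_one).2 fun _ => Real.abs_cos_le_one _

theorem unitIntervalCos_sq (n : ℕ) (t : unitInterval) :
    unitIntervalCos n t ^ 2 = (1 + unitIntervalCos (2 * n) t) / 2 := by
  simp only [unitIntervalCos, ContinuousMap.coe_mk, Real.cos_sq]
  push_cast
  ring_nf

/-- The Riemann–Lebesgue lemma for indicator functions on the unit interval. -/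
theorem tendsto_setIntegral_unitIntervalCos {A : Set unitInterval} (hA : MeasurableSet A) :
    Tendsto (fun n => ∫ t in A, unitIntervalCos n t) atTop (𝓝 0) := by
  have hemb : MeasurableEmbedding ((↑) : unitInterval → ℝ) :=
    MeasurableEmbedding.subtype_coe measurableSet_Icc
  set B : Set ℝ := (↑) '' A
  have hB : MeasurableSet B := hemb.measurableSet_image.2 hA
  have hBfin : volume B ≠ ⊤ :=
    measure_ne_top_of_subset (by rintro _ ⟨t, -, rfl⟩; exact t.2)
      (measure_Icc_lt_top (μ := volume) (a := (0 : ℝ)) (b := 1)).ne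
  have hcoc : Tendsto (fun n : ℕ => (n : ℝ)) atTop (cocompact ℝ) :=
    tendsto_natCast_atTop_atTop.mono_right atTop_le_cocompact
  have hRL := (Complex.continuous_re.tendsto _).comp
    ((Real.tendsto_integral_exp_smul_cocompact (B.indicator fun _ => (1 : ℂ))).comp hcoc)
  rw [Complex.zero_re] at hRL
  refine hRL.congr fun n => ?_
  have hint : Integrable (fun v : ℝ => (Real.fourierChar (-(v * n)) : ℂ)) (volume.restrict B) := by
    have : IsFiniteMeasure (volume.restrict B) := isFiniteMeasure_restrict.2 hBfin
    refine Integrable.of_bound (C := 1) (Continuous.aestronglyMeasurable ?_)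
      (.of_forall fun v => (Circle.norm_coe _).le)
    fun_prop
  have hind : (fun v : ℝ => Real.fourierChar (-(v * n)) • B.indicator (fun _ => (1 : ℂ)) v) =
      B.indicator fun v => (Real.fourierChar (-(v * n)) : ℂ) := by
    ext v
    by_cases hv : v ∈ B <;> simp [hv, Circle.smul_def]
  have hre (v : ℝ) : (Real.fourierChar (-(v * n)) : ℂ).re = Real.cos (2 * Real.pi * (v * n)) := by
    rw [Real.fourierChar_apply, Complex.exp_ofReal_mul_I_re, mul_neg, Real.cos_neg]
  calc (∫ v : ℝ, Real.fourierChar (-(v * n)) • B.indicator (fun _ => (1 : ℂ)) v).re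
      = (∫ v in B, (Real.fourierChar (-(v * n)) : ℂ)).re := by rw [hind, integral_indicator hB]
    _ = ∫ v in B, Real.cos (2 * Real.pi * (v * n)) := by
      simp_rw [← hre]
      exact (integral_re hint).symm
    _ = ∫ t in A, unitIntervalCos n t := by
      have hmap : Measure.map ((↑) : unitInterval → ℝ) volume =
          volume.restrict (Set.Icc 0 1) := map_comap_subtype_coe measurableSet_Icc _
      have hpre : ((↑) : unitInterval → ℝ) ⁻¹' B = A :=
        Set.preimage_image_eq A Subtype.val_injective
      have hsub : B ⊆ Set.Icc 0 1 := by rintro _ ⟨t, -, rfl⟩; exact t.2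
      have := hemb.setIntegral_map (μ := volume) (fun v => Real.cos (2 * Real.pi * (v * n))) B
      rw [hmap, hpre, Measure.restrict_restrict hB, Set.inter_eq_left.2 hsub] at this
      exact this

theorem setIntegral_pos_unitIntervalCos_ge (n : ℕ) :
    1 / 4 + (∫ t, unitIntervalCos n t) / 2 + (∫ t, unitIntervalCos (2 * n) t) / 4 ≤
      ∫ t in {t | 0 < unitIntervalCos n t}, unitIntervalCos n t := by
  have hint (f : C(unitInterval, ℝ)) : Integrable f volume :=
    f.continuous.integrable_of_hasCompactSupport (HasCompactSupport.of_compactSpace _)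
  have hmeas : MeasurableSet {t | 0 < unitIntervalCos n t} :=
    (isOpen_lt continuous_const (unitIntervalCos n).continuous).measurableSet
  have hquarter : Integrable (fun _ : unitInterval => (1 / 4 : ℝ)) volume := integrable_const _
  have hsum : Integrable (fun t => 1 / 4 + unitIntervalCos n t / 2) volume :=
    hquarter.add ((hint _).div_const 2)
  rw [← integral_indicator hmeas]
  calc _ = ∫ t, (1 / 4 + unitIntervalCos n t / 2 + unitIntervalCos (2 * n) t / 4) := by
        rw [integral_add hsum ((hint _).div_const 4),
          integral_add hquarter ((hint _).div_const 2)]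
        simp [integral_div]
    _ ≤ _ := by
      refine integral_mono (hsum.add ((hint _).div_const 4)) ((hint _).indicator hmeas) fun t => ?_
      have hsq := unitIntervalCos_sq n t
      obtain ⟨hl, hu⟩ := abs_le.1
        (((unitIntervalCos n).norm_coe_le_norm t).trans (norm_unitIntervalCos_le_one n))
      by_cases ht : 0 < unitIntervalCos n t
      · rw [Set.indicator_of_mem (by exact ht)]
        nlinarith
      · rw [Set.indicator_of_notMem (by exact ht)]
        nlinarith

/-- Example 7 of the paper: the representing measure `A ↦ φ_A` does not
have relatively compact range. With `λ` Lebesgue measure on `[0,1]` and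
`φ_A(g) = ∫_A g dλ`, the set `{φ_A : A Borel}` is not totally bounded (equivalently, not
relatively compact) in the dual of `C([0,1],ℝ)`. -/
theorem statement10
    (φ : Set unitInterval → (C(unitInterval, ℝ) →L[ℝ] ℝ))
    (hφ : ∀ (A : Set unitInterval) (g : C(unitInterval, ℝ)),
      φ A g = ∫ t in A, g t ∂(volume : Measure unitInterval)) :
    ¬ TotallyBounded {ψ : C(unitInterval, ℝ) →L[ℝ] ℝ |
      ∃ A : Set unitInterval, MeasurableSet A ∧ φ A = ψ} := by
  have hlim := fun {A : Set unitInterval} => tendsto_setIntegral_unitIntervalCos (A := A)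
  have huniv := hlim MeasurableSet.univ
  simp only [Measure.restrict_univ] at huniv
  have hdouble : Tendsto (fun n => ∫ t, unitIntervalCos (2 * n) t) atTop (𝓝 0) :=
    huniv.comp (tendsto_id.const_mul_atTop' two_pos)
  intro htb
  have hunif := htb.eventually_forall_norm_apply_lt norm_unitIntervalCos_le_one
    (by rintro _ ⟨A, hA, rfl⟩; simpa only [hφ] using hlim hA) (ε := 1 / 8) (by norm_num)
  obtain ⟨n, hn, h₁, h₂⟩ := (hunif.and ((huniv.eventually_const_lt
    (show (-1 / 16 : ℝ) < 0 by norm_num)).and (hdouble.eventually_const_lt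
    (show (-1 / 16 : ℝ) < 0 by norm_num)))).exists
  have hlt := hn _ ⟨{t | 0 < unitIntervalCos n t},
    (isOpen_lt continuous_const (unitIntervalCos n).continuous).measurableSet, rfl⟩
  rw [hφ] at hlt
  linarith [(Real.le_norm_self _).trans_lt hlt, setIntegral_pos_unitIntervalCos_ge n]
end
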